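/- arXiv:1908.05112 — 2 statements merged into one kernel-verified Lean document; each statement's English description precedes it below -/
import Mathlib

section
/- Fix ε₁, ε₂, ε₃, ε₄ ∈ {−1, +1}. For t ∈ (−1,1)∖{0} define α(t) = (1 + t|t|)^{−1/2}·(−√2|t|, ε₁|t|, ε₂|t|, ε₃|t|, ε₄) ∈ ℝ⁵, and set R(t) = I₅ − 2·J₁·α(t)·α(t)ᵀ for t > 0 (where J₁ = diag(−1,1,1,1,1)) and R(t) = I₅ + 2·J₋₁·α(t)·α(t)ᵀ for t < 0 (where J₋₁ = diag(−1,1,1,1,−1)); let ρ_{|t|} = diag(1,1,1,1,1/|t|). Then the map t ↦ ρ_{|t|}·R(t)·ρ_{|t|}^{−1}, defined for t ∈ (−1,1)∖{0}, extends to a C¹ map M : (−1,1) → M₅(ℝ), with M(0) equal to the matrix whose top-left 4×4 block is the identity, whose last column is (0,0,0,0,−1)ᵀ, and whose last row is (2√2·ε₄, −2ε₄ε₁, −2ε₄ε₂, −2ε₄ε₃, −1). -/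
open Matrix

/-- The normalised covector `α(t) = (1+t|t|)^{-1/2}·(-√2|t|, ε₁|t|, ε₂|t|, ε₃|t|, ε₄)`. -/
noncomputable def alphaKS (ε₁ ε₂ ε₃ ε₄ t : ℝ) : Fin 5 → ℝ :=
  (Real.sqrt (1 + t * |t|))⁻¹ •
    ![-Real.sqrt 2 * |t|, ε₁ * |t|, ε₂ * |t|, ε₃ * |t|, ε₄]

/-- `J₁ = diag(-1,1,1,1,1)`. -/
noncomputable def J1 : Matrix (Fin 5) (Fin 5) ℝ := Matrix.diagonal ![-1, 1, 1, 1, 1]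

/-- `J₋₁ = diag(-1,1,1,1,-1)`. -/
noncomputable def Jm1 : Matrix (Fin 5) (Fin 5) ℝ := Matrix.diagonal ![-1, 1, 1, 1, -1]

/-- The rescaling `ρ_{|t|} = diag(1,1,1,1,1/|t|)`. -/
noncomputable def rhoKS (t : ℝ) : Matrix (Fin 5) (Fin 5) ℝ :=
  Matrix.diagonal ![1, 1, 1, 1, (|t|)⁻¹]

lemma hasDerivAt_mul_abs (t : ℝ) : HasDerivAt (fun x : ℝ => x * |x|) (2 * |t|) t := by
  rcases eq_or_ne t 0 with rfl | ht
  · rw [hasDerivAt_iff_tendsto_slope_zero]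
    have h : Filter.Tendsto (fun x : ℝ => |x|) (nhdsWithin 0 {0}ᶜ) (nhds (2 * |0|)) := by
      simpa using (continuous_abs.tendsto (0 : ℝ)).mono_left nhdsWithin_le_nhds
    refine h.congr' ?_
    filter_upwards [self_mem_nhdsWithin] with x hx
    have hx : x ≠ 0 := hx
    simp [hx]
  · refine ((hasDerivAt_id t).mul (hasDerivAt_abs ht)).congr_deriv ?_
    rcases lt_or_gt_of_ne ht with h | h
    · simp [h, abs_of_neg h]; ring
    · simp [h, abs_of_pos h]; ring

lemma contDiff_mul_abs : ContDiff ℝ 1 (fun x : ℝ => x * |x|) := by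
  rw [contDiff_one_iff_deriv]
  refine ⟨fun t => (hasDerivAt_mul_abs t).differentiableAt, ?_⟩
  rw [funext fun t => (hasDerivAt_mul_abs t).deriv]
  fun_prop

lemma one_add_mul_abs_pos {t : ℝ} (ht : t ∈ Set.Ioo (-1 : ℝ) 1) : 0 < 1 + t * |t| := by
  obtain ⟨h₁, h₂⟩ := ht
  rcases abs_cases t with ⟨h, _⟩ | ⟨h, _⟩ <;> rw [h] <;> nlinarith

lemma rhoKS_inv {t : ℝ} (ht : t ≠ 0) :
    (rhoKS t)⁻¹ = Matrix.diagonal ![1, 1, 1, 1, |t|] := by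
  refine Matrix.inv_eq_right_inv ?_
  rw [rhoKS, Matrix.diagonal_mul_diagonal, ← Matrix.diagonal_one]
  congr 1
  ext i
  fin_cases i <;> simp [ht]

/-- The `C¹` extension through `t = 0` of the rescaled reflections. -/
noncomputable def rescaledReflection (ε₁ ε₂ ε₃ ε₄ t : ℝ) : Matrix (Fin 5) (Fin 5) ℝ :=
  fun i j => (1 : Matrix (Fin 5) (Fin 5) ℝ) i j - 2 * (1 + t * |t|)⁻¹ *
    (![Real.sqrt 2 * (t * |t|), ε₁ * (t * |t|), ε₂ * (t * |t|), ε₃ * (t * |t|), ε₄] i *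
      ![-Real.sqrt 2, ε₁, ε₂, ε₃, ε₄] j)

lemma contDiffOn_rescaledReflection (ε₁ ε₂ ε₃ ε₄ : ℝ) (i j : Fin 5) :
    ContDiffOn ℝ 1 (fun t => rescaledReflection ε₁ ε₂ ε₃ ε₄ t i j) (Set.Ioo (-1 : ℝ) 1) := by
  have hg : ContDiffOn ℝ 1 (fun x : ℝ => x * |x|) (Set.Ioo (-1 : ℝ) 1) :=
    contDiff_mul_abs.contDiffOn
  have hc : ContDiffOn ℝ 1 (fun t : ℝ => (1 + t * |t|)⁻¹) (Set.Ioo (-1 : ℝ) 1) :=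
    (contDiffOn_const.add hg).inv fun t ht => (one_add_mul_abs_pos ht).ne'
  refine contDiffOn_const.sub ((contDiffOn_const.mul hc).mul (ContDiffOn.mul ?_ contDiffOn_const))
  fin_cases i
  iterate 4 exact contDiffOn_const.mul hg
  exact contDiffOn_const

lemma rescaledReflection_of_pos (ε₁ ε₂ ε₃ ε₄ : ℝ) {t : ℝ} (ht : t ∈ Set.Ioo (-1 : ℝ) 1)
    (h : 0 < t) :
    rescaledReflection ε₁ ε₂ ε₃ ε₄ t = rhoKS t *
      (1 - (2 : ℝ) • (J1 * Matrix.vecMulVec (alphaKS ε₁ ε₂ ε₃ ε₄ t)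
        (alphaKS ε₁ ε₂ ε₃ ε₄ t))) * (rhoKS t)⁻¹ := by
  have hs : (1 + t * |t|)⁻¹ = (Real.sqrt (1 + t * |t|))⁻¹ * (Real.sqrt (1 + t * |t|))⁻¹ := by
    rw [← mul_inv, Real.mul_self_sqrt (one_add_mul_abs_pos ht).le]
  rw [rhoKS_inv h.ne', rhoKS, J1, alphaKS]
  ext i j
  simp only [Matrix.mul_diagonal, Matrix.diagonal_mul, Matrix.sub_apply, Matrix.smul_apply,
    Matrix.vecMulVec_apply, Pi.smul_apply, smul_eq_mul, rescaledReflection, hs]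
  generalize (Real.sqrt (1 + t * |t|))⁻¹ = r
  rw [abs_of_pos h]
  fin_cases i <;> fin_cases j <;> simp <;> field_simp

lemma rescaledReflection_of_neg (ε₁ ε₂ ε₃ ε₄ : ℝ) {t : ℝ} (ht : t ∈ Set.Ioo (-1 : ℝ) 1)
    (h : t < 0) :
    rescaledReflection ε₁ ε₂ ε₃ ε₄ t = rhoKS t *
      (1 + (2 : ℝ) • (Jm1 * Matrix.vecMulVec (alphaKS ε₁ ε₂ ε₃ ε₄ t)
        (alphaKS ε₁ ε₂ ε₃ ε₄ t))) * (rhoKS t)⁻¹ := by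
  have hs : (1 + t * |t|)⁻¹ = (Real.sqrt (1 + t * |t|))⁻¹ * (Real.sqrt (1 + t * |t|))⁻¹ := by
    rw [← mul_inv, Real.mul_self_sqrt (one_add_mul_abs_pos ht).le]
  rw [rhoKS_inv h.ne, rhoKS, Jm1, alphaKS]
  ext i j
  simp only [Matrix.mul_diagonal, Matrix.diagonal_mul, Matrix.add_apply, Matrix.smul_apply,
    Matrix.vecMulVec_apply, Pi.smul_apply, smul_eq_mul, rescaledReflection, hs]
  generalize (Real.sqrt (1 + t * |t|))⁻¹ = r
  rw [abs_of_neg h]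
  have h0 := h.ne
  fin_cases i <;> fin_cases j <;> simp <;> field_simp <;> ring

/-- The rescaled conjugated reflections `ρ_{|t|}·R(t)·ρ_{|t|}⁻¹` in the bounding hyperplanes
`𝔭ᵢ` of the Kerckhoff–Storm polytope (hyperbolic reflections `R(t)=I-2J₁ααᵀ` for `t>0`, AdS
reflections `R(t)=I+2J₋₁ααᵀ` for `t<0`) extend to a `C¹` path of matrices through `t = 0`,
with limit the half-pipe reflection with top-left 4×4 block the identity, last column
`(0,0,0,0,-1)ᵀ` and last row `(2√2ε₄, -2ε₄ε₁, -2ε₄ε₂, -2ε₄ε₃, -1)`. -/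
theorem reflections_spacelike_walls_C1 (ε₁ ε₂ ε₃ ε₄ : ℝ)
    (h₁ : ε₁ = 1 ∨ ε₁ = -1) (h₂ : ε₂ = 1 ∨ ε₂ = -1)
    (h₃ : ε₃ = 1 ∨ ε₃ = -1) (h₄ : ε₄ = 1 ∨ ε₄ = -1) :
    ∃ M : ℝ → Matrix (Fin 5) (Fin 5) ℝ,
      (∀ i j : Fin 5, ContDiffOn ℝ 1 (fun t => M t i j) (Set.Ioo (-1 : ℝ) 1)) ∧
      (∀ t ∈ Set.Ioo (-1 : ℝ) 1, 0 < t →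
        M t = rhoKS t *
          (1 - (2 : ℝ) • (J1 * Matrix.vecMulVec (alphaKS ε₁ ε₂ ε₃ ε₄ t)
            (alphaKS ε₁ ε₂ ε₃ ε₄ t))) * (rhoKS t)⁻¹) ∧
      (∀ t ∈ Set.Ioo (-1 : ℝ) 1, t < 0 →
        M t = rhoKS t *
          (1 + (2 : ℝ) • (Jm1 * Matrix.vecMulVec (alphaKS ε₁ ε₂ ε₃ ε₄ t)
            (alphaKS ε₁ ε₂ ε₃ ε₄ t))) * (rhoKS t)⁻¹) ∧
      M 0 = !![1, 0, 0, 0, 0;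
               0, 1, 0, 0, 0;
               0, 0, 1, 0, 0;
               0, 0, 0, 1, 0;
               2 * Real.sqrt 2 * ε₄, -2 * ε₄ * ε₁, -2 * ε₄ * ε₂, -2 * ε₄ * ε₃, -1] := by
  refine ⟨rescaledReflection ε₁ ε₂ ε₃ ε₄, contDiffOn_rescaledReflection ε₁ ε₂ ε₃ ε₄,
    fun t ht h => rescaledReflection_of_pos ε₁ ε₂ ε₃ ε₄ ht h,
    fun t ht h => rescaledReflection_of_neg ε₁ ε₂ ε₃ ε₄ ht h, ?_⟩
  have h₄' : ε₄ * ε₄ = 1 := by rcases h₄ with rfl | rfl <;> norm_num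
  ext i j
  fin_cases i <;> fin_cases j <;> simp [rescaledReflection, h₄'] <;> ring
end

section
/- For t ∈ (0, 1/√3], let α = (−√2t, t, t, t, 1) and α′ = (−√2t, t, −t, −t, 1) in ℝ⁵. Then q₁(α) = q₁(α′) = 1 + t², b₁(α, α′) = 1 − 3t², and b₁(α,α′)² < q₁(α)·q₁(α′), so the hyperplanes ker⟨α,·⟩ and ker⟨α′,·⟩ intersect transversely in H⁴ and the dihedral angle of the polytope along the corresponding ridge is θ_t = arccos((3t²−1)/(1+t²)). Moreover the function t ↦ arccos((3t²−1)/(1+t²)) is strictly decreasing on (0, 1/√3], takes the value π/2 at t = 1/√3, and tends to π as t → 0⁺. -/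
/-- The quadratic form `q₁(x) = -x₀² + x₁² + x₂² + x₃² + x₄²` on `ℝ⁵`. -/
noncomputable def q1 (x : Fin 5 → ℝ) : ℝ :=
  -(x 0) ^ 2 + (x 1) ^ 2 + (x 2) ^ 2 + (x 3) ^ 2 + (x 4) ^ 2

/-- The associated bilinear form `b₁`. -/
noncomputable def b1 (x y : Fin 5 → ℝ) : ℝ :=
  -(x 0 * y 0) + x 1 * y 1 + x 2 * y 2 + x 3 * y 3 + x 4 * y 4

/-- The bounding covector `𝔭₀ = (-√2t, t, t, t, 1)` of the Kerckhoff–Storm polytope. -/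
noncomputable def p0KS (t : ℝ) : Fin 5 → ℝ := ![-Real.sqrt 2 * t, t, t, t, 1]

/-- The bounding covector `𝔭₂ = (-√2t, t, -t, -t, 1)` of the Kerckhoff–Storm polytope. -/
noncomputable def p2KS (t : ℝ) : Fin 5 → ℝ := ![-Real.sqrt 2 * t, t, -t, -t, 1]

theorem sq_le_third_of_mem_Ioc {t : ℝ} (ht : t ∈ Set.Ioc (0 : ℝ) (1 / Real.sqrt 3)) :
    t ^ 2 ≤ 1 / 3 := by
  have h := pow_le_pow_left₀ ht.1.le ht.2 2
  rwa [div_pow, Real.sq_sqrt (by norm_num), one_pow] at h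

theorem q1_p0KS (t : ℝ) : q1 (p0KS t) = 1 + t ^ 2 := by
  have h2 : Real.sqrt 2 ^ 2 = 2 := Real.sq_sqrt (by norm_num)
  simp [q1, p0KS]
  linear_combination -t ^ 2 * h2

theorem q1_p2KS (t : ℝ) : q1 (p2KS t) = 1 + t ^ 2 := by
  have h2 : Real.sqrt 2 ^ 2 = 2 := Real.sq_sqrt (by norm_num)
  simp [q1, p2KS]
  linear_combination -t ^ 2 * h2

theorem b1_p0KS_p2KS (t : ℝ) : b1 (p0KS t) (p2KS t) = 1 - 3 * t ^ 2 := by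
  have h2 : Real.sqrt 2 ^ 2 = 2 := Real.sq_sqrt (by norm_num)
  simp [b1, p0KS, p2KS]
  linear_combination -t ^ 2 * h2

/-- The non-constant dihedral angle of the hyperbolic Kerckhoff–Storm polytope:
`θ_t = arccos((3t²-1)/(1+t²))`, which is strictly decreasing, equals `π/2` at `t = 1/√3`,
and tends to `π` as `t → 0⁺`. -/
theorem hyperbolic_dihedral_angle :
    (∀ t ∈ Set.Ioc (0 : ℝ) (1 / Real.sqrt 3),
      q1 (p0KS t) = 1 + t ^ 2 ∧
      q1 (p2KS t) = 1 + t ^ 2 ∧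
      b1 (p0KS t) (p2KS t) = 1 - 3 * t ^ 2 ∧
      (b1 (p0KS t) (p2KS t)) ^ 2 < q1 (p0KS t) * q1 (p2KS t) ∧
      (∃ x : Fin 5 → ℝ, q1 x < 0 ∧ 0 < x 0 ∧
        (∑ i, p0KS t i * x i) = 0 ∧ (∑ i, p2KS t i * x i) = 0) ∧
      Real.arccos (-(b1 (p0KS t) (p2KS t)) / Real.sqrt (q1 (p0KS t) * q1 (p2KS t)))
        = Real.arccos ((3 * t ^ 2 - 1) / (1 + t ^ 2))) ∧
    StrictAntiOn (fun t : ℝ => Real.arccos ((3 * t ^ 2 - 1) / (1 + t ^ 2)))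
      (Set.Ioc (0 : ℝ) (1 / Real.sqrt 3)) ∧
    Real.arccos ((3 * (1 / Real.sqrt 3) ^ 2 - 1) / (1 + (1 / Real.sqrt 3) ^ 2))
      = Real.pi / 2 ∧
    Filter.Tendsto (fun t : ℝ => Real.arccos ((3 * t ^ 2 - 1) / (1 + t ^ 2)))
      (nhdsWithin 0 (Set.Ioi 0)) (nhds Real.pi) := by
  refine ⟨fun t ht => ?_, fun a ha b hb hab => ?_, ?_, ?_⟩
  · have hs := sq_le_third_of_mem_Ioc ht
    have hpos : 0 < t ^ 2 := pow_pos ht.1 2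
    rw [q1_p0KS, q1_p2KS, b1_p0KS_p2KS]
    refine ⟨rfl, rfl, rfl, by nlinarith, ⟨![1, 0, 0, 0, Real.sqrt 2 * t], ?_, ?_, ?_, ?_⟩, ?_⟩
    · simp [q1, mul_pow]
      linarith
    · simp
    · simp [p0KS, Fin.sum_univ_five]
    · simp [p2KS, Fin.sum_univ_five]
    · rw [Real.sqrt_mul_self (by positivity), neg_sub]
  · have hlt : a ^ 2 < b ^ 2 := pow_lt_pow_left₀ hab ha.1.le two_ne_zero
    have hb3 := sq_le_third_of_mem_Ioc hb
    have hpa : 0 < 1 + a ^ 2 := by positivity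
    have hpb : 0 < 1 + b ^ 2 := by positivity
    refine Real.arccos_lt_arccos ?_ ?_ ?_
    · rw [le_div_iff₀ hpa]
      nlinarith [sq_nonneg a]
    · rw [div_lt_div_iff₀ hpa hpb]
      nlinarith
    · rw [div_le_one hpb]
      nlinarith
  · rw [div_pow, Real.sq_sqrt (by norm_num)]
    norm_num
  · have hc : Continuous fun t : ℝ => Real.arccos ((3 * t ^ 2 - 1) / (1 + t ^ 2)) :=
      Real.continuous_arccos.comp
        (Continuous.div (by fun_prop) (by fun_prop) fun t => by positivity)
    have h := (hc.tendsto 0).mono_left (nhdsWithin_le_nhds (s := Set.Ioi 0))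
    simpa using h
end
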